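/- Let 1 ≤ a < b and δ > 0. Then liminf_{n→∞, n even} (4/n²) ln ∫_{Σ_{n,a,b,δ}} Z_n^{−1} |Δ(μ)|² e^{−Σ_{j=1}^{n/2} μ_j²/2} dμ ≥ 1 − a + ln a. -/

import Mathlib

open MeasureTheory

noncomputable section

/-- The open Weyl chamber `Σ_n`: strictly decreasing positive vectors. -/
def SigmaN (m : ℕ) : Set (Fin m → ℝ) :=
  {μ | (∀ i j : Fin m, i < j → μ j < μ i) ∧ ∀ i, 0 < μ i}

/-- The Vandermonde-type determinant `Δ(μ) = ∏_{i<j} (μ_i² − μ_j²)`. -/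
def VdM (m : ℕ) (μ : Fin m → ℝ) : ℝ :=
  ∏ p ∈ Finset.univ.filter (fun p : Fin m × Fin m => p.1 < p.2), (μ p.1 ^ 2 - μ p.2 ^ 2)

/-- The normalization constant `Z_n = (π/2)^{n/4} ∏_{j=0}^{n/2−1} (2j)!`. -/
def Zn (n : ℕ) : ℝ :=
  (Real.pi / 2) ^ ((n : ℝ) / 4) * ∏ j ∈ Finset.range (n / 2), (Nat.factorial (2 * j) : ℝ)


/-- The set `Σ_{n,a,b,δ} = Σ_{n,a,b} \ Σ_{n,>δ}`; on `Σ_n` the largest coordinate is `μ_1`,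
so the condition `μ_1² ≤ δ·C(n,2)` is expressed as `∀ i, μ i ^ 2 ≤ δ·C(n,2)`. -/
def SigABD (n : ℕ) (a b δ : ℝ) : Set (Fin (n / 2) → ℝ) :=
  {μ | μ ∈ SigmaN (n / 2) ∧
    (a * (n.choose 2 : ℝ) < ∑ j, μ j ^ 2 ∧ ∑ j, μ j ^ 2 < b * (n.choose 2 : ℝ)) ∧
    ∀ i, μ i ^ 2 ≤ δ * (n.choose 2 : ℝ)}

/-! ### Hermite polynomials over `ℝ` and the Gaussian weight -/

open Polynomial in
/-- The probabilists' Hermite polynomial with real coefficients. -/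
def hermiteReal (n : ℕ) : ℝ[X] := (hermite n).map (Int.castRingHom ℝ)

open Polynomial in
theorem integrable_eval_mul_gaussian (p : ℝ[X]) :
    Integrable fun x : ℝ => p.eval x * Real.exp (-x ^ 2 / 2) := by
  induction p using Polynomial.induction_on' with
  | add p q hp hq =>
    exact (hp.add hq).congr (Filter.Eventually.of_forall fun x => by simp [add_mul])
  | monomial n c =>
    have h := (integrable_rpow_mul_exp_neg_mul_sq (b := 1 / 2) (by norm_num) (s := n)
      (by have : (0 : ℝ) ≤ n := n.cast_nonneg
          linarith)).const_mul c
    refine h.congr (Filter.Eventually.of_forall fun x => ?_)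
    simp only [eval_monomial, Real.rpow_natCast]
    rw [show -(1 / 2 : ℝ) * x ^ 2 = -x ^ 2 / 2 by ring]
    ring

open Polynomial in
theorem integral_X_mul_eval_mul_gaussian (p : ℝ[X]) :
    ∫ x : ℝ, (X * p).eval x * Real.exp (-x ^ 2 / 2)
      = ∫ x : ℝ, (derivative p).eval x * Real.exp (-x ^ 2 / 2) := by
  have hd : ∀ x : ℝ, HasDerivAt (fun x => p.eval x * Real.exp (-x ^ 2 / 2))
      ((derivative p).eval x * Real.exp (-x ^ 2 / 2)
        - (X * p).eval x * Real.exp (-x ^ 2 / 2)) x := by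
    intro x
    have h1 : HasDerivAt (fun x : ℝ => Real.exp (-x ^ 2 / 2))
        (Real.exp (-x ^ 2 / 2) * (-x)) x := by
      have h2 : HasDerivAt (fun x : ℝ => -x ^ 2 / 2) (-x) x := by
        have h3 := ((hasDerivAt_pow 2 x).fun_neg).div_const 2
        exact h3.congr_deriv (by norm_num; ring)
      exact h2.exp
    refine ((p.hasDerivAt x).fun_mul h1).congr_deriv ?_
    rw [eval_mul, eval_X]
    ring
  have h := integral_eq_zero_of_hasDerivAt_of_integrable hd
    ((integrable_eval_mul_gaussian _).sub (integrable_eval_mul_gaussian _))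
    (integrable_eval_mul_gaussian _)
  rw [integral_sub (integrable_eval_mul_gaussian _) (integrable_eval_mul_gaussian _)] at h
  linarith

open Polynomial in
theorem hermiteReal_succ (n : ℕ) :
    hermiteReal (n + 1) = X * hermiteReal n - derivative (hermiteReal n) := by
  simp [hermiteReal, hermite_succ]

open Polynomial in
theorem hermiteReal_zero : hermiteReal 0 = 1 := by simp [hermiteReal]

open Polynomial in
theorem monic_hermiteReal (n : ℕ) : (hermiteReal n).Monic := (hermite_monic n).map _

open Polynomial in
theorem natDegree_hermiteReal (n : ℕ) : (hermiteReal n).natDegree = n := by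
  rw [hermiteReal, (hermite_monic n).natDegree_map, natDegree_hermite]

open Polynomial in
theorem derivative_hermiteReal_succ (n : ℕ) :
    derivative (hermiteReal (n + 1)) = C ((n : ℝ) + 1) * hermiteReal n := by
  induction n with
  | zero => simp [hermiteReal]
  | succ n ih =>
    rw [hermiteReal_succ (n + 1), ih, derivative_sub, derivative_mul, ih, derivative_mul,
      hermiteReal_succ n]
    simp
    ring

open Polynomial in
theorem hermiteReal_add_two (n : ℕ) :
    hermiteReal (n + 2) = X * hermiteReal (n + 1) - C ((n : ℝ) + 1) * hermiteReal n := by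
  rw [hermiteReal_succ (n + 1), derivative_hermiteReal_succ]

open Polynomial in
theorem integral_hermiteReal_mul_eval (n : ℕ) (p : ℝ[X]) :
    ∫ x : ℝ, (hermiteReal n * p).eval x * Real.exp (-x ^ 2 / 2)
      = ∫ x : ℝ, (derivative^[n] p).eval x * Real.exp (-x ^ 2 / 2) := by
  induction n generalizing p with
  | zero => simp [hermiteReal_zero]
  | succ n ih =>
    rw [Function.iterate_succ_apply, ← ih (derivative p)]
    have h := integral_X_mul_eval_mul_gaussian (hermiteReal n * p)
    have e : hermiteReal (n + 1) * p
        = X * (hermiteReal n * p) - derivative (hermiteReal n) * p := by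
      rw [hermiteReal_succ]; ring
    rw [derivative_mul] at h
    simp only [e, eval_sub, eval_add, sub_mul, add_mul] at h ⊢
    rw [integral_sub (integrable_eval_mul_gaussian _) (integrable_eval_mul_gaussian _), h,
      integral_add (integrable_eval_mul_gaussian _) (integrable_eval_mul_gaussian _)]
    ring

theorem integral_gaussian_weight :
    ∫ x : ℝ, Real.exp (-x ^ 2 / 2) = 2 * √(Real.pi / 2) := by
  have h := integral_gaussian (1 / 2)
  have e : ∀ x : ℝ, -(1 / 2 : ℝ) * x ^ 2 = -x ^ 2 / 2 := fun x => by ring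
  simp only [e] at h
  rw [h, show Real.pi / (1 / 2) = 2 ^ 2 * (Real.pi / 2) by ring, Real.sqrt_mul (by norm_num),
    Real.sqrt_sq (by norm_num)]

open Polynomial in
theorem integral_hermiteReal_mul_of_lt {i j : ℕ} (h : i < j) :
    ∫ x : ℝ, (hermiteReal j * hermiteReal i).eval x * Real.exp (-x ^ 2 / 2) = 0 := by
  rw [integral_hermiteReal_mul_eval, iterate_derivative_eq_zero (by
    rwa [natDegree_hermiteReal])]
  simp

open Polynomial in
theorem integral_hermiteReal_mul_of_ne {i j : ℕ} (h : i ≠ j) :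
    ∫ x : ℝ, (hermiteReal i * hermiteReal j).eval x * Real.exp (-x ^ 2 / 2) = 0 := by
  rcases lt_or_gt_of_ne h with h | h
  · rw [mul_comm]; exact integral_hermiteReal_mul_of_lt h
  · exact integral_hermiteReal_mul_of_lt h

open Polynomial in
theorem iterate_derivative_hermiteReal (n : ℕ) :
    derivative^[n] (hermiteReal n) = C (n.factorial : ℝ) := by
  induction n with
  | zero => simp [hermiteReal_zero]
  | succ n ih =>
    rw [Function.iterate_succ_apply, derivative_hermiteReal_succ, iterate_derivative_C_mul, ih,
      ← C_mul, Nat.factorial_succ]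
    push_cast
    rfl

open Polynomial in
theorem integral_hermiteReal_sq (n : ℕ) :
    ∫ x : ℝ, (hermiteReal n * hermiteReal n).eval x * Real.exp (-x ^ 2 / 2)
      = 2 * √(Real.pi / 2) * n.factorial := by
  rw [integral_hermiteReal_mul_eval, iterate_derivative_hermiteReal]
  simp only [eval_C]
  rw [integral_const_mul, integral_gaussian_weight]
  ring

open Polynomial in
theorem X_sq_mul_hermiteReal (n : ℕ) :
    X ^ 2 * hermiteReal n = hermiteReal (n + 2) + C (2 * (n : ℝ) + 1) * hermiteReal n
      + C ((n : ℝ) * ((n : ℝ) - 1)) * hermiteReal (n - 2) := by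
  have hC : (C 2 : ℝ[X]) = 2 := map_ofNat C 2
  rcases n with _ | _ | n
  · rw [hermiteReal_add_two, hermiteReal_succ]
    simp [hermiteReal_zero]
    ring
  · rw [hermiteReal_add_two, hermiteReal_add_two, hermiteReal_succ]
    simp [hermiteReal_zero, hC]
    ring
  · rw [hermiteReal_add_two (n + 2), hermiteReal_add_two (n + 1), hermiteReal_add_two n]
    simp [hC]
    ring

open Polynomial in
theorem integral_pow_four_mul_hermiteReal_sq_le (n : ℕ) :
    ∫ x : ℝ, (X ^ 4 * (hermiteReal n * hermiteReal n)).eval x * Real.exp (-x ^ 2 / 2)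
      ≤ 21 * ((n : ℝ) + 1) ^ 2 * (2 * √(Real.pi / 2) * n.factorial) := by
  set c : ℝ := 2 * (n : ℝ) + 1
  set d : ℝ := (n : ℝ) * ((n : ℝ) - 1)
  have key : ∀ x : ℝ, (X ^ 4 * (hermiteReal n * hermiteReal n)).eval x
      ≤ 3 * (hermiteReal (n + 2) * hermiteReal (n + 2)).eval x
        + 3 * c ^ 2 * (hermiteReal n * hermiteReal n).eval x
        + 3 * d ^ 2 * (hermiteReal (n - 2) * hermiteReal (n - 2)).eval x := by
    intro x
    have e := congrArg (eval x) (X_sq_mul_hermiteReal n)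
    simp only [eval_mul, eval_add, eval_pow, eval_X, eval_C] at e ⊢
    set u := eval x (hermiteReal (n + 2))
    set v := c * eval x (hermiteReal n) with hv
    set t := d * eval x (hermiteReal (n - 2)) with ht
    have e2 : x ^ 4 * (eval x (hermiteReal n) * eval x (hermiteReal n)) = (u + v + t) ^ 2 := by
      rw [← e]; ring
    rw [e2]
    have : 3 * c ^ 2 * (eval x (hermiteReal n) * eval x (hermiteReal n)) = 3 * v ^ 2 := by
      rw [hv]; ring
    have h' : 3 * d ^ 2 * (eval x (hermiteReal (n - 2)) * eval x (hermiteReal (n - 2)))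
        = 3 * t ^ 2 := by
      rw [ht]; ring
    rw [this, h']
    nlinarith [sq_nonneg (u - v), sq_nonneg (u - t), sq_nonneg (v - t)]
  have hi := fun k => integrable_eval_mul_gaussian (hermiteReal k * hermiteReal k)
  have h1 : ∫ x : ℝ, (X ^ 4 * (hermiteReal n * hermiteReal n)).eval x * Real.exp (-x ^ 2 / 2)
      ≤ ∫ x : ℝ, (3 * ((hermiteReal (n + 2) * hermiteReal (n + 2)).eval x * Real.exp (-x ^ 2 / 2))
        + 3 * c ^ 2 * ((hermiteReal n * hermiteReal n).eval x * Real.exp (-x ^ 2 / 2))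
        + 3 * d ^ 2 * ((hermiteReal (n - 2) * hermiteReal (n - 2)).eval x
          * Real.exp (-x ^ 2 / 2))) := by
    refine integral_mono (integrable_eval_mul_gaussian _)
      ((((hi _).const_mul _).add ((hi _).const_mul _)).add ((hi _).const_mul _)) fun x => ?_
    have := mul_le_mul_of_nonneg_right (key x) (Real.exp_pos (-x ^ 2 / 2)).le
    simp only
    linarith
  rw [integral_add (((hi _).const_mul _).fun_add ((hi _).const_mul _)) ((hi _).const_mul _),
    integral_add ((hi _).const_mul _) ((hi _).const_mul _), integral_const_mul,
    integral_const_mul, integral_const_mul, integral_hermiteReal_sq, integral_hermiteReal_sq,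
    integral_hermiteReal_sq] at h1
  have f1 : ((n + 2).factorial : ℝ) = ((n : ℝ) + 2) * ((n : ℝ) + 1) * n.factorial := by
    rw [Nat.factorial_succ, Nat.factorial_succ]; push_cast; ring
  have f2 : d ^ 2 * ((n - 2).factorial : ℝ) = d * n.factorial := by
    rcases n with _ | _ | n
    · simp [d]
    · simp [d]
    · simp only [d, Nat.factorial_succ]; push_cast; ring
  set s := 2 * √(Real.pi / 2) with hs
  have hs0 : 0 ≤ s := by positivity
  have hn : (0 : ℝ) ≤ n := n.cast_nonneg
  have hf : (0 : ℝ) ≤ s * n.factorial := by positivity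
  have e3 : 3 * (s * ((n + 2).factorial : ℝ)) + 3 * c ^ 2 * (s * n.factorial)
      + 3 * d ^ 2 * (s * ((n - 2).factorial : ℝ))
      = (3 * (((n : ℝ) + 2) * ((n : ℝ) + 1)) + 3 * c ^ 2 + 3 * d) * (s * n.factorial) := by
    rw [f1]; linear_combination 3 * s * f2
  rw [e3] at h1
  refine h1.trans (mul_le_mul_of_nonneg_right ?_ hf)
  simp only [c, d]
  nlinarith

/-! ### Even Hermite polynomials on the half line -/

open Polynomial in
theorem exists_expand_eq_hermiteReal (k : ℕ) :
    ∃ q : ℝ[X], q.Monic ∧ q.natDegree = k ∧ expand ℝ 2 q = hermiteReal (2 * k) := by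
  have h : expand ℝ 2 (contract 2 (hermiteReal (2 * k))) = hermiteReal (2 * k) := by
    ext n
    rw [coeff_expand (by norm_num)]
    split_ifs with hn
    · rw [coeff_contract (by norm_num), Nat.div_mul_cancel hn]
    · have : coeff (hermite (2 * k)) n = 0 :=
        coeff_hermite_of_odd_add (by
          rw [← Nat.not_even_iff_odd, Nat.even_add]
          simp [even_iff_two_dvd, hn])
      simp [hermiteReal, this]
  refine ⟨_, ?_, ?_, h⟩
  · rw [← monic_expand_iff (p := 2) (by norm_num), h]
    exact monic_hermiteReal _
  · have := natDegree_expand 2 (contract 2 (hermiteReal (2 * k)))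
    rw [h, natDegree_hermiteReal] at this
    omega

open Polynomial in
theorem eval_abs_hermiteReal_two_mul (k : ℕ) (x : ℝ) :
    (hermiteReal (2 * k)).eval |x| = (hermiteReal (2 * k)).eval x := by
  obtain ⟨q, -, -, hq⟩ := exists_expand_eq_hermiteReal k
  rw [← hq, expand_eval, expand_eval, sq_abs]

open Polynomial in
theorem setIntegral_Ioi_eval_mul_gaussian (p : ℝ[X]) (hp : ∀ x : ℝ, p.eval |x| = p.eval x) :
    ∫ x in Set.Ioi (0 : ℝ), p.eval x * Real.exp (-x ^ 2 / 2)
      = (∫ x : ℝ, p.eval x * Real.exp (-x ^ 2 / 2)) / 2 := by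
  have h := integral_comp_abs (f := fun x : ℝ => p.eval x * Real.exp (-x ^ 2 / 2))
  simp only [hp, sq_abs] at h
  linarith

open Polynomial in
/-- The `2k`-th Hermite function, whose square carries the weight `exp (-x² / 2)`. -/
def evenHermiteFun (k : ℕ) (x : ℝ) : ℝ :=
  (hermiteReal (2 * k)).eval x * Real.exp (-x ^ 2 / 4)

theorem exp_quarter_mul_self (x : ℝ) :
    Real.exp (-x ^ 2 / 4) * Real.exp (-x ^ 2 / 4) = Real.exp (-x ^ 2 / 2) := by
  rw [← Real.exp_add]; congr 1; ring

open Polynomial in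
theorem pow_mul_evenHermiteFun_mul (d i j : ℕ) (x : ℝ) :
    x ^ d * (evenHermiteFun i x * evenHermiteFun j x)
      = (X ^ d * (hermiteReal (2 * i) * hermiteReal (2 * j))).eval x
        * Real.exp (-x ^ 2 / 2) := by
  rw [← exp_quarter_mul_self]
  simp [evenHermiteFun]
  ring

theorem integrable_pow_mul_evenHermiteFun_mul (d i j : ℕ) :
    Integrable (fun x => x ^ d * (evenHermiteFun i x * evenHermiteFun j x))
      (volume.restrict (Set.Ioi 0)) := by
  simp only [pow_mul_evenHermiteFun_mul]
  exact (integrable_eval_mul_gaussian _).restrict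

theorem setIntegral_pow_mul_evenHermiteFun_mul (d : ℕ) (hd : Even d) (i j : ℕ) :
    ∫ x in Set.Ioi (0 : ℝ), x ^ d * (evenHermiteFun i x * evenHermiteFun j x)
      = (∫ x : ℝ, (Polynomial.X ^ d * (hermiteReal (2 * i) * hermiteReal (2 * j))).eval x
        * Real.exp (-x ^ 2 / 2)) / 2 := by
  simp only [pow_mul_evenHermiteFun_mul]
  refine setIntegral_Ioi_eval_mul_gaussian _ fun x => ?_
  simp [eval_abs_hermiteReal_two_mul, hd.pow_abs]

theorem setIntegral_evenHermiteFun_mul_of_ne {i j : ℕ} (h : i ≠ j) :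
    ∫ x in Set.Ioi (0 : ℝ), evenHermiteFun i x * evenHermiteFun j x = 0 := by
  have := setIntegral_pow_mul_evenHermiteFun_mul 0 (by simp) i j
  simp only [pow_zero, one_mul] at this
  rw [this, integral_hermiteReal_mul_of_ne (by omega), zero_div]

theorem setIntegral_evenHermiteFun_sq (i : ℕ) :
    ∫ x in Set.Ioi (0 : ℝ), evenHermiteFun i x * evenHermiteFun i x
      = √(Real.pi / 2) * (2 * i).factorial := by
  have := setIntegral_pow_mul_evenHermiteFun_mul 0 (by simp) i i
  simp only [pow_zero, one_mul] at this
  rw [this, integral_hermiteReal_sq]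
  ring

theorem setIntegral_pow_four_mul_evenHermiteFun_sq_le (i : ℕ) :
    ∫ x in Set.Ioi (0 : ℝ), x ^ 4 * (evenHermiteFun i x * evenHermiteFun i x)
      ≤ 21 * (2 * (i : ℝ) + 1) ^ 2 * (√(Real.pi / 2) * (2 * i).factorial) := by
  rw [setIntegral_pow_mul_evenHermiteFun_mul 4 (by decide)]
  have := integral_pow_four_mul_hermiteReal_sq_le (2 * i)
  push_cast at this
  linarith

/-! ### Integrals of squared determinants -/

theorem prod_mul_det_sq_eq {m : ℕ} (G f : Fin m → ℝ → ℝ) (x : Fin m → ℝ) :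
    (∏ k, G k (x k)) * (Matrix.of fun i j => f j (x i)).det ^ 2
      = ∑ σ : Equiv.Perm (Fin m), ∑ τ : Equiv.Perm (Fin m),
        ((Equiv.Perm.sign σ : ℤ) : ℝ) * ((Equiv.Perm.sign τ : ℤ) : ℝ) *
          ∏ k, G k (x k) * (f (σ k) (x k) * f (τ k) (x k)) := by
  rw [← Matrix.det_transpose, Matrix.det_apply', sq, Finset.sum_mul_sum, Finset.mul_sum]
  refine Finset.sum_congr rfl fun σ _ => ?_
  rw [Finset.mul_sum]
  refine Finset.sum_congr rfl fun τ _ => ?_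
  simp only [Matrix.transpose_apply, Matrix.of_apply, Finset.prod_mul_distrib]
  ring

theorem integrable_prod_mul_det_sq {m : ℕ} (ρ : Measure ℝ) [SigmaFinite ρ]
    (G f : Fin m → ℝ → ℝ)
    (hfint : ∀ k i j, Integrable (fun x => G k x * (f i x * f j x)) ρ) :
    Integrable (fun x : Fin m → ℝ =>
      (∏ k, G k (x k)) * (Matrix.of fun i j => f j (x i)).det ^ 2) (Measure.pi fun _ => ρ) := by
  simp only [prod_mul_det_sq_eq]
  exact integrable_finsetSum _ fun σ _ => integrable_finsetSum _ fun τ _ =>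
    (Integrable.fintype_prod (f := fun k x => G k x * (f (σ k) x * f (τ k) x))
      fun k => hfint k (σ k) (τ k)).const_mul _

theorem integral_prod_mul_det_sq {m : ℕ} (ρ : Measure ℝ) [SigmaFinite ρ]
    (G f : Fin m → ℝ → ℝ)
    (hfint : ∀ k i j, Integrable (fun x => G k x * (f i x * f j x)) ρ)
    (horth : ∀ σ τ : Equiv.Perm (Fin m), σ ≠ τ →
      ∃ k, ∫ x, G k x * (f (σ k) x * f (τ k) x) ∂ρ = 0) :
    ∫ x, (∏ k, G k (x k)) * (Matrix.of fun i j => f j (x i)).det ^ 2 ∂(Measure.pi fun _ => ρ)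
      = ∑ σ : Equiv.Perm (Fin m), ∏ k, ∫ x, G k x * (f (σ k) x * f (σ k) x) ∂ρ := by
  have hi : ∀ σ τ : Equiv.Perm (Fin m), Integrable (fun x : Fin m → ℝ =>
      ((Equiv.Perm.sign σ : ℤ) : ℝ) * ((Equiv.Perm.sign τ : ℤ) : ℝ) *
          ∏ k, G k (x k) * (f (σ k) (x k) * f (τ k) (x k))) (Measure.pi fun _ => ρ) :=
    fun σ τ => (Integrable.fintype_prod (f := fun k x => G k x * (f (σ k) x * f (τ k) x))
      fun k => hfint k (σ k) (τ k)).const_mul _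
  simp only [prod_mul_det_sq_eq]
  rw [integral_finsetSum _ fun σ _ => integrable_finsetSum _ fun τ _ => hi σ τ]
  refine Finset.sum_congr rfl fun σ _ => ?_
  rw [integral_finsetSum _ fun τ _ => hi σ τ, Finset.sum_eq_single σ]
  · rw [integral_const_mul,
      integral_fintype_prod_eq_prod (fun k x => G k x * (f (σ k) x * f (σ k) x))]
    rcases Int.units_eq_one_or (Equiv.Perm.sign σ) with h | h <;> simp [h]
  · intro τ _ hτ
    obtain ⟨k, hk⟩ := horth σ τ hτ.symm
    rw [integral_const_mul,
      integral_fintype_prod_eq_prod (fun k x => G k x * (f (σ k) x * f (τ k) x)),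
      Finset.prod_eq_zero (Finset.mem_univ k) hk, mul_zero]
  · simp

theorem exists_ne_and_apply_ne {m : ℕ} {σ τ : Equiv.Perm (Fin m)} (h : σ ≠ τ) (i : Fin m) :
    ∃ k, k ≠ i ∧ σ k ≠ τ k := by
  by_contra! hc
  apply h
  have key : ∀ k, σ k = τ k := by
    intro k
    by_cases hk : k = i
    · subst hk
      by_contra hne
      obtain ⟨l, hl⟩ := τ.surjective (σ k)
      have hlk : l ≠ k := by
        rintro rfl
        exact hne hl.symm
      have := hc l hlk
      exact hlk (σ.injective (this.trans hl))
    · exact hc k hk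
  exact Equiv.ext key

/-! ### The weight on the positive orthant -/

/-- The open positive orthant. -/
def posOrthant (m : ℕ) : Set (Fin m → ℝ) := {μ | ∀ i, 0 < μ i}

theorem posOrthant_eq_pi (m : ℕ) :
    posOrthant m = Set.univ.pi fun _ : Fin m => Set.Ioi (0 : ℝ) := by
  ext μ; simp [posOrthant]

theorem measurableSet_posOrthant (m : ℕ) : MeasurableSet (posOrthant m) := by
  rw [posOrthant_eq_pi]
  exact MeasurableSet.univ_pi fun _ => measurableSet_Ioi

theorem restrict_posOrthant (m : ℕ) :
    (volume : Measure (Fin m → ℝ)).restrict (posOrthant m)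
      = Measure.pi fun _ : Fin m => (volume : Measure ℝ).restrict (Set.Ioi 0) := by
  rw [posOrthant_eq_pi, volume_pi, Measure.restrict_pi_pi]

theorem VdM_eq_prod_Ioi (m : ℕ) (μ : Fin m → ℝ) :
    VdM m μ = ∏ i : Fin m, ∏ j ∈ Finset.Ioi i, (μ i ^ 2 - μ j ^ 2) := by
  rw [VdM, Finset.prod_filter, ← Finset.univ_product_univ, Finset.prod_product]
  refine Finset.prod_congr rfl fun i _ => ?_
  rw [← Finset.prod_filter]
  refine Finset.prod_congr ?_ fun _ _ => rfl
  ext j; simp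

theorem VdM_sq_eq_det_sq (m : ℕ) (μ : Fin m → ℝ) :
    VdM m μ ^ 2 = (Matrix.vandermonde fun i => μ i ^ 2).det ^ 2 := by
  rw [VdM_eq_prod_Ioi, Matrix.det_vandermonde, ← Finset.prod_pow, ← Finset.prod_pow]
  refine Finset.prod_congr rfl fun i _ => ?_
  rw [← Finset.prod_pow, ← Finset.prod_pow]
  exact Finset.prod_congr rfl fun j _ => by ring

theorem VdM_sq_mul_exp_eq (m : ℕ) (μ : Fin m → ℝ) :
    VdM m μ ^ 2 * Real.exp (-(∑ j, μ j ^ 2) / 2)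
      = (Matrix.of fun i j : Fin m => evenHermiteFun j (μ i)).det ^ 2 := by
  choose q hq1 hq2 hq3 using exists_expand_eq_hermiteReal
  have h1 : (Matrix.of fun i j : Fin m => evenHermiteFun j (μ i))
      = Matrix.of fun i j : Fin m => Real.exp (-μ i ^ 2 / 4) *
        (Matrix.of fun i j : Fin m => (q j).eval (μ i ^ 2)) i j := by
    ext i j
    simp only [Matrix.of_apply, evenHermiteFun]
    rw [← hq3, Polynomial.expand_eval, mul_comm]
  rw [h1, Matrix.det_mul_column, VdM_sq_eq_det_sq,
    Matrix.det_eval_matrixOfPolynomials_eq_det_vandermonde (fun i => μ i ^ 2)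
      (fun j : Fin m => q j) (fun j => hq2 j) (fun j => hq1 j), mul_pow, mul_comm,
    ← Real.exp_sum, sq (Real.exp _), ← Real.exp_add]
  congr 2
  rw [← Finset.sum_add_distrib, ← Finset.sum_neg_distrib, Finset.sum_div]
  exact Finset.sum_congr rfl fun i _ => by ring

theorem sum_card_Ioi_fin (m : ℕ) : ∑ i : Fin m, (Finset.Ioi i).card = m.choose 2 := by
  simp only [Fin.card_Ioi]
  rw [Fin.sum_univ_eq_sum_range (fun i => m - 1 - i), Finset.sum_range_reflect (fun i => i),
    Finset.sum_range_id, Nat.choose_two_right]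

theorem add_four_mul_choose_two (m : ℕ) : m + 4 * m.choose 2 = (2 * m).choose 2 := by
  induction m with
  | zero => rfl
  | succ m ih =>
    rw [show 2 * (m + 1) = 2 * m + 1 + 1 by ring, Nat.choose_succ_succ' (2 * m + 1) 1,
      Nat.choose_succ_succ' (2 * m) 1, Nat.choose_succ_succ' m 1]
    simp only [Nat.choose_one_right, Nat.reduceAdd]
    omega

theorem VdM_smul (m : ℕ) (R : ℝ) (μ : Fin m → ℝ) :
    VdM m (R • μ) = R ^ (2 * m.choose 2) * VdM m μ := by
  rw [VdM_eq_prod_Ioi, VdM_eq_prod_Ioi, ← sum_card_Ioi_fin, pow_mul, ← Finset.prod_pow_eq_pow_sum,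
    ← Finset.prod_mul_distrib]
  refine Finset.prod_congr rfl fun i _ => ?_
  rw [← Finset.prod_const, ← Finset.prod_mul_distrib]
  refine Finset.prod_congr rfl fun j _ => ?_
  simp only [Pi.smul_apply, smul_eq_mul]
  ring

/-- The mass of the weight on the Weyl chamber. -/
def chamberMass (m : ℕ) : ℝ := ∏ j : Fin m, (√(Real.pi / 2) * (2 * (j : ℕ)).factorial)

theorem chamberMass_pos (m : ℕ) : 0 < chamberMass m :=
  Finset.prod_pos fun _ _ => by positivity

theorem chamberMass_eq_Zn (m : ℕ) : chamberMass m = Zn (2 * m) := by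
  rw [chamberMass, Fin.prod_univ_eq_prod_range (fun j => √(Real.pi / 2) * ((2 * j).factorial : ℝ)),
    Finset.prod_mul_distrib, Zn, Nat.mul_div_cancel_left _ (by norm_num)]
  congr 1
  rw [Finset.prod_const, Finset.card_range, Real.sqrt_eq_rpow, ← Real.rpow_natCast,
    ← Real.rpow_mul (by positivity)]
  congr 1
  push_cast
  ring

theorem prod_pow_mul_VdM_sq_mul_exp_eq (m : ℕ) (e : Fin m → ℕ) (μ : Fin m → ℝ) :
    (∏ k, μ k ^ e k) * (VdM m μ ^ 2 * Real.exp (-(∑ j, μ j ^ 2) / 2))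
      = (∏ k, (fun k x => x ^ e k : Fin m → ℝ → ℝ) k (μ k)) *
        (Matrix.of fun i j => (fun j x => evenHermiteFun j x : Fin m → ℝ → ℝ) j (μ i)).det ^ 2 := by
  rw [VdM_sq_mul_exp_eq]

theorem integrableOn_prod_pow_mul_weight (m : ℕ) (e : Fin m → ℕ) :
    IntegrableOn (fun μ : Fin m → ℝ =>
      (∏ k, μ k ^ e k) * (VdM m μ ^ 2 * Real.exp (-(∑ j, μ j ^ 2) / 2))) (posOrthant m) := by
  rw [IntegrableOn, restrict_posOrthant]
  simp only [prod_pow_mul_VdM_sq_mul_exp_eq]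
  exact integrable_prod_mul_det_sq _ _ _ fun k i j =>
    integrable_pow_mul_evenHermiteFun_mul (e k) i j

theorem setIntegral_prod_pow_mul_weight (m : ℕ) (e : Fin m → ℕ)
    (he : ∀ σ τ : Equiv.Perm (Fin m), σ ≠ τ → ∃ k, e k = 0 ∧ σ k ≠ τ k) :
    ∫ μ in posOrthant m, (∏ k, μ k ^ e k) * (VdM m μ ^ 2 * Real.exp (-(∑ j, μ j ^ 2) / 2))
      = ∑ σ : Equiv.Perm (Fin m), ∏ k, ∫ x in Set.Ioi (0 : ℝ),
        x ^ e k * (evenHermiteFun (σ k) x * evenHermiteFun (σ k) x) := by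
  rw [restrict_posOrthant]
  simp only [prod_pow_mul_VdM_sq_mul_exp_eq]
  refine integral_prod_mul_det_sq _ _ _ (fun k i j =>
    integrable_pow_mul_evenHermiteFun_mul (e k) i j) fun σ τ h => ?_
  obtain ⟨k, hk, hne⟩ := he σ τ h
  refine ⟨k, ?_⟩
  change ∫ x in Set.Ioi (0 : ℝ),
    x ^ e k * (evenHermiteFun (σ k) x * evenHermiteFun (τ k) x) = 0
  simpa [hk] using setIntegral_evenHermiteFun_mul_of_ne fun h => hne (Fin.ext h)

theorem integrableOn_weight (m : ℕ) :
    IntegrableOn (fun μ : Fin m → ℝ => VdM m μ ^ 2 * Real.exp (-(∑ j, μ j ^ 2) / 2))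
      (posOrthant m) := by
  simpa using integrableOn_prod_pow_mul_weight m 0

theorem setIntegral_weight (m : ℕ) :
    ∫ μ in posOrthant m, VdM m μ ^ 2 * Real.exp (-(∑ j, μ j ^ 2) / 2)
      = m.factorial * chamberMass m := by
  have h := setIntegral_prod_pow_mul_weight m 0 fun σ τ hne => by
    by_contra! hc
    exact hne (Equiv.ext fun k => hc k rfl)
  simp only [Pi.zero_apply, pow_zero, Finset.prod_const_one, one_mul] at h
  rw [h]
  have : ∀ σ : Equiv.Perm (Fin m), ∏ k, ∫ x in Set.Ioi (0 : ℝ),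
      evenHermiteFun (σ k) x * evenHermiteFun (σ k) x = chamberMass m := by
    intro σ
    simp only [setIntegral_evenHermiteFun_sq]
    exact Equiv.prod_comp σ fun j : Fin m => √(Real.pi / 2) * ((2 * (j : ℕ)).factorial : ℝ)
  simp [this, Fintype.card_perm]

theorem prod_pow_ite_four {m : ℕ} (i : Fin m) (μ : Fin m → ℝ) :
    ∏ k, μ k ^ (if k = i then 4 else 0) = μ i ^ 4 := by
  simp [pow_ite]

theorem integrableOn_pow_four_mul_weight (m : ℕ) (i : Fin m) :
    IntegrableOn (fun μ : Fin m → ℝ =>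
      μ i ^ 4 * (VdM m μ ^ 2 * Real.exp (-(∑ j, μ j ^ 2) / 2))) (posOrthant m) := by
  simpa only [prod_pow_ite_four] using
    integrableOn_prod_pow_mul_weight m fun k => if k = i then 4 else 0

theorem setIntegral_pow_four_mul_weight_le (m : ℕ) (i : Fin m) :
    ∫ μ in posOrthant m, μ i ^ 4 * (VdM m μ ^ 2 * Real.exp (-(∑ j, μ j ^ 2) / 2))
      ≤ 84 * (m : ℝ) ^ 2 * (m.factorial * chamberMass m) := by
  have h := setIntegral_prod_pow_mul_weight m (fun k => if k = i then 4 else 0) fun σ τ hne => by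
    obtain ⟨k, hk, hk'⟩ := exists_ne_and_apply_ne hne i
    exact ⟨k, by simp [hk], hk'⟩
  simp only [prod_pow_ite_four] at h
  rw [h]
  have key : ∀ σ : Equiv.Perm (Fin m), ∏ k, ∫ x in Set.Ioi (0 : ℝ),
      x ^ (if k = i then 4 else 0) * (evenHermiteFun (σ k) x * evenHermiteFun (σ k) x)
        ≤ 84 * (m : ℝ) ^ 2 * chamberMass m := by
    intro σ
    have e : 84 * (m : ℝ) ^ 2 * chamberMass m = ∏ k : Fin m,
        (if k = i then 84 * (m : ℝ) ^ 2 else 1) *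
          (√(Real.pi / 2) * ((2 * (σ k : ℕ)).factorial : ℝ)) := by
      rw [Finset.prod_mul_distrib, Finset.prod_ite_eq']
      simp only [Finset.mem_univ, if_true]
      congr 1
      exact (Equiv.prod_comp σ
        fun j : Fin m => √(Real.pi / 2) * ((2 * (j : ℕ)).factorial : ℝ)).symm
    rw [e]
    refine Finset.prod_le_prod (fun k _ => ?_) fun k _ => ?_
    · refine setIntegral_nonneg measurableSet_Ioi fun x hx => ?_
      have : (0 : ℝ) < x := hx
      exact mul_nonneg (by positivity) (mul_self_nonneg _)
    · by_cases hk : k = i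
      · simp only [hk, if_true]
        refine (setIntegral_pow_four_mul_evenHermiteFun_sq_le _).trans
          (mul_le_mul_of_nonneg_right ?_ (by positivity))
        have h1 : ((σ i : ℕ) : ℝ) + 1 ≤ m := by exact_mod_cast (σ i).isLt
        have h0 : (0 : ℝ) ≤ ((σ i : ℕ) : ℝ) := Nat.cast_nonneg _
        nlinarith
      · simp only [hk, if_false, pow_zero, one_mul]
        rw [setIntegral_evenHermiteFun_sq]
  refine (Finset.sum_le_sum fun σ _ => key σ).trans (le_of_eq ?_)
  simp [Fintype.card_perm]
  ring

/-! ### Scaling -/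

theorem smul_mem_posOrthant_iff {m : ℕ} {R : ℝ} (hR : 0 < R) (μ : Fin m → ℝ) :
    R • μ ∈ posOrthant m ↔ μ ∈ posOrthant m := by
  simp [posOrthant, hR]

open Pointwise in
theorem smul_posOrthant {m : ℕ} {R : ℝ} (hR : 0 < R) : R • posOrthant m = posOrthant m := by
  ext μ
  rw [Set.mem_smul_set_iff_inv_smul_mem₀ hR.ne', smul_mem_posOrthant_iff (inv_pos.2 hR)]

theorem comp_sqrt_smul_eq {m d : ℕ} {h : (Fin m → ℝ) → ℝ}
    (hh : ∀ R : ℝ, 0 < R → ∀ μ, h (R • μ) = R ^ d * h μ) {t : ℝ} (ht : 0 < t) (μ : Fin m → ℝ) :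
    h (√t • μ) * Real.exp (-(∑ j, (√t • μ) j ^ 2) / 2)
      = √t ^ d * (h μ * Real.exp (-(t * ∑ j, μ j ^ 2) / 2)) := by
  rw [hh _ (Real.sqrt_pos.2 ht)]
  simp only [Pi.smul_apply, smul_eq_mul, mul_pow, Real.sq_sqrt ht.le, ← Finset.mul_sum]
  ring

theorem setIntegral_mul_exp_scale {m d : ℕ} {h : (Fin m → ℝ) → ℝ}
    (hh : ∀ R : ℝ, 0 < R → ∀ μ, h (R • μ) = R ^ d * h μ) {t : ℝ} (ht : 0 < t) :
    ∫ μ in posOrthant m, h μ * Real.exp (-(t * ∑ j, μ j ^ 2) / 2)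
      = (√t ^ (m + d))⁻¹ *
        ∫ μ in posOrthant m, h μ * Real.exp (-(∑ j, μ j ^ 2) / 2) := by
  have hR := Real.sqrt_pos.2 ht
  have h1 := Measure.setIntegral_comp_smul_of_pos volume
    (fun μ : Fin m → ℝ => h μ * Real.exp (-(∑ j, μ j ^ 2) / 2)) (posOrthant m) hR
  simp only [comp_sqrt_smul_eq hh ht] at h1
  rw [integral_const_mul, smul_posOrthant hR, Module.finrank_fin_fun, smul_eq_mul] at h1
  rw [pow_add, mul_inv, mul_right_comm, ← h1]
  have : √t ^ d ≠ 0 := (pow_pos hR d).ne'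
  field_simp

theorem integrableOn_mul_exp_scale {m d : ℕ} {h : (Fin m → ℝ) → ℝ}
    (hh : ∀ R : ℝ, 0 < R → ∀ μ, h (R • μ) = R ^ d * h μ)
    (hi : IntegrableOn (fun μ => h μ * Real.exp (-(∑ j, μ j ^ 2) / 2)) (posOrthant m))
    {t : ℝ} (ht : 0 < t) :
    IntegrableOn (fun μ => h μ * Real.exp (-(t * ∑ j, μ j ^ 2) / 2)) (posOrthant m) := by
  have hR := Real.sqrt_pos.2 ht
  rw [← integrable_indicator_iff (measurableSet_posOrthant m)] at hi ⊢
  rw [← integrable_comp_smul_iff volume _ hR.ne'] at hi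
  refine (hi.const_mul (√t ^ d)⁻¹).congr (Filter.Eventually.of_forall fun μ => ?_)
  have : √t ^ d ≠ 0 := (pow_pos hR d).ne'
  by_cases hμ : μ ∈ posOrthant m
  · simp only [Set.indicator_of_mem ((smul_mem_posOrthant_iff hR μ).2 hμ),
      Set.indicator_of_mem hμ]
    rw [comp_sqrt_smul_eq hh ht]
    field_simp
  · simp only [Set.indicator_of_notMem (mt (smul_mem_posOrthant_iff hR μ).1 hμ),
      Set.indicator_of_notMem hμ, mul_zero]

theorem VdM_sq_smul (m : ℕ) (R : ℝ) (μ : Fin m → ℝ) :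
    VdM m (R • μ) ^ 2 = R ^ (4 * m.choose 2) * VdM m μ ^ 2 := by
  rw [VdM_smul]; ring

theorem pow_four_mul_VdM_sq_smul (m : ℕ) (i : Fin m) (R : ℝ) (μ : Fin m → ℝ) :
    (R • μ) i ^ 4 * VdM m (R • μ) ^ 2
      = R ^ (4 * m.choose 2 + 4) * (μ i ^ 4 * VdM m μ ^ 2) := by
  rw [VdM_sq_smul, Pi.smul_apply, smul_eq_mul]; ring

/-- The weight at inverse temperature `t`. -/
def scaledWeight (m : ℕ) (t : ℝ) (μ : Fin m → ℝ) : ℝ :=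
  VdM m μ ^ 2 * Real.exp (-(t * ∑ j, μ j ^ 2) / 2)

theorem scaledWeight_nonneg (m : ℕ) (t : ℝ) (μ : Fin m → ℝ) : 0 ≤ scaledWeight m t μ :=
  mul_nonneg (sq_nonneg _) (Real.exp_pos _).le

theorem scaledWeight_one (m : ℕ) (μ : Fin m → ℝ) :
    scaledWeight m 1 μ = VdM m μ ^ 2 * Real.exp (-(∑ j, μ j ^ 2) / 2) := by
  rw [scaledWeight, one_mul]

theorem integrableOn_scaledWeight (m : ℕ) {t : ℝ} (ht : 0 < t) :
    IntegrableOn (scaledWeight m t) (posOrthant m) :=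
  integrableOn_mul_exp_scale (fun R _ μ => VdM_sq_smul m R μ) (integrableOn_weight m) ht

theorem setIntegral_scaledWeight (m : ℕ) {t : ℝ} (ht : 0 < t) :
    ∫ μ in posOrthant m, scaledWeight m t μ
      = (√t ^ (2 * m).choose 2)⁻¹ * (m.factorial * chamberMass m) := by
  rw [← setIntegral_weight, ← add_four_mul_choose_two]
  exact setIntegral_mul_exp_scale (fun R _ μ => VdM_sq_smul m R μ) ht

theorem integrableOn_pow_four_mul_scaledWeight (m : ℕ) (i : Fin m) {t : ℝ} (ht : 0 < t) :
    IntegrableOn (fun μ => μ i ^ 4 * scaledWeight m t μ) (posOrthant m) := by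
  have hi := integrableOn_pow_four_mul_weight m i
  simp only [← mul_assoc] at hi
  have := integrableOn_mul_exp_scale (h := fun μ => μ i ^ 4 * VdM m μ ^ 2) (fun R _ μ => pow_four_mul_VdM_sq_smul m i R μ) hi ht
  simpa only [scaledWeight, mul_assoc] using this

theorem setIntegral_pow_four_mul_scaledWeight_le (m : ℕ) (i : Fin m) {t : ℝ} (ht : 0 < t) :
    ∫ μ in posOrthant m, μ i ^ 4 * scaledWeight m t μ
      ≤ (√t ^ (2 * m).choose 2)⁻¹ * (t ^ 2)⁻¹ *
        (84 * (m : ℝ) ^ 2 * (m.factorial * chamberMass m)) := by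
  have h := setIntegral_mul_exp_scale (h := fun μ => μ i ^ 4 * VdM m μ ^ 2)
    (fun R _ μ => pow_four_mul_VdM_sq_smul m i R μ) ht
  have e : √t ^ (m + (4 * m.choose 2 + 4)) = √t ^ (2 * m).choose 2 * t ^ 2 := by
    rw [← add_assoc, add_four_mul_choose_two, pow_add, show (4 : ℕ) = 2 * 2 by rfl, pow_mul (√t) 2,
      Real.sq_sqrt ht.le]
  simp only [e, mul_assoc] at h
  simp only [scaledWeight]
  rw [h, mul_inv]
  have h4 := setIntegral_pow_four_mul_weight_le m i
  have := mul_le_mul_of_nonneg_left h4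
    (show 0 ≤ (√t ^ (2 * m).choose 2)⁻¹ * (t ^ 2)⁻¹ by positivity)
  simpa only [mul_assoc] using this

/-! ### Concentration -/

/-- Positive vectors whose squared norm lies in a window and whose coordinates are not large. -/
def windowSet (m : ℕ) (N a c δ : ℝ) : Set (Fin m → ℝ) :=
  {μ | μ ∈ posOrthant m ∧ (a * N < ∑ j, μ j ^ 2 ∧ ∑ j, μ j ^ 2 < c * N) ∧ ∀ i, μ i ^ 2 ≤ δ * N}

theorem windowSet_subset_posOrthant (m : ℕ) (N a c δ : ℝ) :
    windowSet m N a c δ ⊆ posOrthant m := fun _ h => h.1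

theorem measurableSet_windowSet (m : ℕ) (N a c δ : ℝ) : MeasurableSet (windowSet m N a c δ) := by
  have h : windowSet m N a c δ = posOrthant m ∩ ({μ | a * N < ∑ j, μ j ^ 2} ∩
      {μ | ∑ j, μ j ^ 2 < c * N} ∩ ⋂ i, {μ | μ i ^ 2 ≤ δ * N}) := by
    ext μ
    simp [windowSet]
    tauto
  rw [h]
  exact (measurableSet_posOrthant m).inter
    (((measurableSet_lt (by fun_prop) (by fun_prop)).inter
      (measurableSet_lt (by fun_prop) (by fun_prop))).inter
        (MeasurableSet.iInter fun i => measurableSet_le (by fun_prop) (by fun_prop)))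

/-- The rate `√x · exp ((1 - x) / 2)` of the Chernoff bound. -/
def chernoffRate (x : ℝ) : ℝ := √x * Real.exp ((1 - x) / 2)

theorem chernoffRate_nonneg (x : ℝ) : 0 ≤ chernoffRate x := by
  unfold chernoffRate; positivity

theorem chernoffRate_lt_one {x : ℝ} (hx1 : x ≠ 1) : chernoffRate x < 1 := by
  have h := Real.add_one_lt_exp (sub_ne_zero.2 hx1)
  have h2 : √x < Real.exp ((x - 1) / 2) := by
    rw [Real.sqrt_lt' (Real.exp_pos _), ← Real.exp_nat_mul]
    convert h using 1
    · ring
    · congr 1; push_cast; ring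
  calc chernoffRate x < Real.exp ((x - 1) / 2) * Real.exp ((1 - x) / 2) :=
        mul_lt_mul_of_pos_right h2 (Real.exp_pos _)
    _ = 1 := by rw [← Real.exp_add, ← Real.exp_zero]; congr 1; ring

theorem scaledWeight_mul_exp_tilt (m : ℕ) {t c N : ℝ} (hc : 0 < c) (μ : Fin m → ℝ) :
    scaledWeight m t μ * Real.exp ((t - 1 / c) * (∑ j, μ j ^ 2 - c * N) / 2)
      = Real.exp ((1 - t * c) * N / 2) * scaledWeight m (1 / c) μ := by
  rw [scaledWeight, scaledWeight, mul_assoc, ← Real.exp_add, mul_left_comm, ← Real.exp_add]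
  congr 2
  field_simp
  ring

theorem one_sub_le_indicator_windowSet {m : ℕ} {N a a₁ c δ : ℝ} (hN : 0 < N) (ha : 0 < a)
    (haa : a < a₁) (hac : a₁ < c) (hδ : 0 < δ) {μ : Fin m → ℝ} (hμ : μ ∈ posOrthant m) :
    1 - Real.exp ((1 / a₁ - 1 / a) * (∑ j, μ j ^ 2 - a * N) / 2)
        - Real.exp ((1 / a₁ - 1 / c) * (∑ j, μ j ^ 2 - c * N) / 2)
        - (∑ i, μ i ^ 4) / (δ * N) ^ 2
      ≤ (windowSet m N a c δ).indicator 1 μ := by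
  have e1 := Real.exp_pos ((1 / a₁ - 1 / a) * (∑ j, μ j ^ 2 - a * N) / 2)
  have e2 := Real.exp_pos ((1 / a₁ - 1 / c) * (∑ j, μ j ^ 2 - c * N) / 2)
  have e3 : 0 ≤ (∑ i, μ i ^ 4) / (δ * N) ^ 2 :=
    div_nonneg (Finset.sum_nonneg fun i _ => by positivity) (by positivity)
  by_cases h : μ ∈ windowSet m N a c δ
  · rw [Set.indicator_of_mem h, Pi.one_apply]
    linarith
  · rw [Set.indicator_of_notMem h]
    by_cases h1 : a * N < ∑ j, μ j ^ 2
    · by_cases h2 : ∑ j, μ j ^ 2 < c * N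
      · have h3 : ∃ i, δ * N < μ i ^ 2 := by
          by_contra! h3
          exact h ⟨hμ, ⟨h1, h2⟩, h3⟩
        obtain ⟨i, hi⟩ := h3
        have h4 : (δ * N) ^ 2 ≤ ∑ i, μ i ^ 4 := by
          calc (δ * N) ^ 2 ≤ (μ i ^ 2) ^ 2 := by gcongr
            _ = μ i ^ 4 := by ring
            _ ≤ _ := Finset.single_le_sum (f := fun i => μ i ^ 4) (fun i _ => by positivity)
              (Finset.mem_univ i)
        have h5 : 1 ≤ (∑ i, μ i ^ 4) / (δ * N) ^ 2 := by
          rw [le_div_iff₀ (by positivity)]; linarith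
        linarith
      · have h3 : 1 / c ≤ 1 / a₁ := one_div_le_one_div_of_le (by linarith) hac.le
        have := Real.one_le_exp (x := (1 / a₁ - 1 / c) * (∑ j, μ j ^ 2 - c * N) / 2)
          (div_nonneg (mul_nonneg (by linarith) (by linarith)) (by norm_num))
        linarith
    · have h3 : 1 / a₁ ≤ 1 / a := one_div_le_one_div_of_le ha haa.le
      have := Real.one_le_exp (x := (1 / a₁ - 1 / a) * (∑ j, μ j ^ 2 - a * N) / 2)
        (div_nonneg (mul_nonneg_of_nonpos_of_nonpos (by linarith) (by linarith)) (by norm_num))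
      linarith

theorem exp_mul_sqrt_pow_eq_chernoffRate {a₁ c : ℝ} (h₁ : 0 < a₁) (hc : 0 < c) (N : ℕ) :
    Real.exp ((1 - 1 / a₁ * c) * N / 2) * (√(1 / c) ^ N)⁻¹
      = (√(1 / a₁) ^ N)⁻¹ * chernoffRate (c / a₁) ^ N := by
  have : Real.exp ((1 - 1 / a₁ * c) * N / 2) = Real.exp ((1 - c / a₁) / 2) ^ N := by
    rw [← Real.exp_nat_mul]; congr 1; ring
  rw [this, chernoffRate, mul_pow, Real.sqrt_div hc.le, one_div, one_div, Real.sqrt_inv,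
    Real.sqrt_inv, div_pow, inv_pow, inv_pow, inv_inv, inv_inv]
  have : √a₁ ^ N ≠ 0 := (pow_pos (Real.sqrt_pos.2 h₁) N).ne'
  field_simp

theorem le_setIntegral_windowSet_scaledWeight {m : ℕ} (hm : 0 < m) {a a₁ c δ : ℝ} (ha : 0 < a)
    (haa : a < a₁) (hac : a₁ < c) (hδ : 0 < δ) :
    (√(1 / a₁) ^ (2 * m).choose 2)⁻¹ * (m.factorial * chamberMass m) *
        (1 - chernoffRate (a / a₁) ^ (2 * m).choose 2 - chernoffRate (c / a₁) ^ (2 * m).choose 2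
          - 84 * a₁ ^ 2 * (m : ℝ) ^ 3 / (δ * (2 * m).choose 2) ^ 2)
      ≤ ∫ μ in windowSet m ((2 * m).choose 2) a c δ, scaledWeight m (1 / a₁) μ := by
  have h₁ : 0 < a₁ := ha.trans haa
  have hc : 0 < c := h₁.trans hac
  have ht : 0 < 1 / a₁ := by positivity
  have hNpos : 0 < (2 * m).choose 2 := Nat.choose_pos (by omega)
  generalize hN : (2 * m).choose 2 = N at *
  have hN0 : (0 : ℝ) < N := by exact_mod_cast hNpos
  set t := 1 / a₁ with htdef
  set M : ℝ := m.factorial * chamberMass m with hM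
  have hM0 : 0 ≤ M := mul_nonneg (by positivity) (chamberMass_pos m).le
  have i0 := integrableOn_scaledWeight m ht
  have ia := (integrableOn_scaledWeight m (one_div_pos.2 ha)).const_mul
    (Real.exp ((1 - t * a) * N / 2))
  have ic := (integrableOn_scaledWeight m (one_div_pos.2 hc)).const_mul
    (Real.exp ((1 - t * c) * N / 2))
  have i4 : IntegrableOn (fun μ => ∑ i, μ i ^ 4 * scaledWeight m t μ) (posOrthant m) :=
    integrable_finsetSum _ fun i _ => integrableOn_pow_four_mul_scaledWeight m i ht
  have i4' := i4.div_const ((δ * N) ^ 2)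
  have key : ∫ μ in posOrthant m, (scaledWeight m t μ
        - Real.exp ((1 - t * a) * N / 2) * scaledWeight m (1 / a) μ
        - Real.exp ((1 - t * c) * N / 2) * scaledWeight m (1 / c) μ
        - (∑ i, μ i ^ 4 * scaledWeight m t μ) / (δ * N) ^ 2)
      ≤ ∫ μ in posOrthant m,
        (windowSet m N a c δ).indicator (scaledWeight m t) μ := by
    refine setIntegral_mono_on (((i0.sub ia).sub ic).sub i4')
      (i0.indicator (measurableSet_windowSet _ _ _ _ _)) (measurableSet_posOrthant m)
      fun μ hμ => ?_
    have h := mul_le_mul_of_nonneg_left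
      (one_sub_le_indicator_windowSet hN0 ha haa hac hδ hμ) (scaledWeight_nonneg m t μ)
    rw [← htdef, mul_sub, mul_sub, mul_sub, scaledWeight_mul_exp_tilt m ha,
      scaledWeight_mul_exp_tilt m hc, mul_one] at h
    have e1 : scaledWeight m t μ * (windowSet m N a c δ).indicator 1 μ
        = (windowSet m N a c δ).indicator (scaledWeight m t) μ := by
      by_cases hw : μ ∈ windowSet m N a c δ <;> simp [hw]
    have e2 : (∑ i, μ i ^ 4 * scaledWeight m t μ) / (δ * N) ^ 2
        = scaledWeight m t μ * ((∑ i, μ i ^ 4) / (δ * N) ^ 2) := by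
      rw [← Finset.sum_mul]; ring
    rw [e1] at h
    rw [e2]
    exact h
  rw [setIntegral_indicator (measurableSet_windowSet _ _ _ _ _),
    Set.inter_eq_self_of_subset_right (windowSet_subset_posOrthant _ _ _ _ _)] at key
  refine le_trans ?_ key
  rw [integral_sub ((i0.fun_sub ia).fun_sub ic) i4', integral_sub (i0.fun_sub ia) ic,
    integral_sub i0 ia, integral_const_mul, integral_const_mul, integral_div,
    integral_finsetSum _ fun i _ => integrableOn_pow_four_mul_scaledWeight m i ht,
    setIntegral_scaledWeight m ht, setIntegral_scaledWeight m (one_div_pos.2 ha),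
    setIntegral_scaledWeight m (one_div_pos.2 hc), hN, ← hM]
  have e : ∀ r : ℝ, 0 < r → Real.exp ((1 - t * r) * N / 2) * ((√(1 / r) ^ N)⁻¹ * M)
      = (√t ^ N)⁻¹ * M * chernoffRate (r / a₁) ^ N := fun r hr => by
    rw [← mul_assoc, exp_mul_sqrt_pow_eq_chernoffRate h₁ hr]
    ring
  rw [e a ha, e c hc]
  have h4 : (∑ i : Fin m, ∫ μ in posOrthant m, μ i ^ 4 * scaledWeight m t μ) / (δ * N) ^ 2
      ≤ (√t ^ N)⁻¹ * M * (84 * a₁ ^ 2 * (m : ℝ) ^ 3 / (δ * N) ^ 2) := by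
    have h5 := Finset.sum_le_sum fun (i : Fin m) (_ : i ∈ Finset.univ) =>
      setIntegral_pow_four_mul_scaledWeight_le m i ht
    rw [Finset.sum_const, Finset.card_univ, Fintype.card_fin, nsmul_eq_mul, hN, ← hM] at h5
    rw [mul_div_assoc', div_le_div_iff_of_pos_right (by positivity)]
    refine h5.trans (le_of_eq ?_)
    have : (t ^ 2)⁻¹ = a₁ ^ 2 := by rw [htdef, one_div, inv_pow, inv_inv]
    rw [this]
    ring
  linarith

/-! ### Symmetrization -/

theorem VdM_sq_comp_perm {m : ℕ} (σ : Equiv.Perm (Fin m)) (μ : Fin m → ℝ) :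
    VdM m (μ ∘ σ) ^ 2 = VdM m μ ^ 2 := by
  rw [VdM_sq_eq_det_sq, VdM_sq_eq_det_sq]
  have : (Matrix.vandermonde fun i => (μ ∘ σ) i ^ 2)
      = (Matrix.vandermonde fun i => μ i ^ 2).submatrix σ id := by
    ext i j; simp [Matrix.vandermonde_apply]
  rw [this, Matrix.det_permute, mul_pow]
  rcases Int.units_eq_one_or (Equiv.Perm.sign σ) with h | h <;> simp [h]

theorem sum_sq_comp_perm {m : ℕ} (σ : Equiv.Perm (Fin m)) (μ : Fin m → ℝ) :
    ∑ j, (μ ∘ σ) j ^ 2 = ∑ j, μ j ^ 2 :=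
  Equiv.sum_comp σ fun j => μ j ^ 2

theorem scaledWeight_comp_perm {m : ℕ} (t : ℝ) (σ : Equiv.Perm (Fin m)) (μ : Fin m → ℝ) :
    scaledWeight m t (μ ∘ σ) = scaledWeight m t μ := by
  rw [scaledWeight, scaledWeight, VdM_sq_comp_perm, sum_sq_comp_perm]

theorem comp_perm_mem_windowSet {m : ℕ} {N a c δ : ℝ} (σ : Equiv.Perm (Fin m)) {μ : Fin m → ℝ}
    (h : μ ∈ windowSet m N a c δ) : μ ∘ σ ∈ windowSet m N a c δ := by
  refine ⟨fun i => h.1 (σ i), ?_, fun i => h.2.2 (σ i)⟩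
  rw [sum_sq_comp_perm]
  exact h.2.1

theorem injective_of_VdM_ne_zero {m : ℕ} {μ : Fin m → ℝ} (h : VdM m μ ≠ 0) :
    Function.Injective μ := by
  intro i j hij
  by_contra hne
  rw [VdM, Finset.prod_ne_zero_iff] at h
  rcases lt_or_gt_of_ne hne with hlt | hlt
  · exact h (i, j) (by simpa using hlt) (by simp [hij])
  · exact h (j, i) (by simpa using hlt) (by simp [hij])

theorem exists_perm_comp_mem_SigmaN {m : ℕ} {μ : Fin m → ℝ} (hpos : μ ∈ posOrthant m)
    (hinj : Function.Injective μ) : ∃ σ : Equiv.Perm (Fin m), μ ∘ σ ∈ SigmaN m := by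
  refine ⟨Tuple.sort fun i => -μ i, ?_, fun i => hpos _⟩
  intro i j hij
  have hmono := Tuple.monotone_sort fun i => -μ i
  have hle := hmono hij.le
  simp only [Function.comp_apply, neg_le_neg_iff] at hle ⊢
  refine lt_of_le_of_ne hle fun he => hij.ne' ?_
  exact (Tuple.sort fun i => -μ i).injective (hinj he)

theorem measurableSet_SigmaN (m : ℕ) : MeasurableSet (SigmaN m) := by
  have h : SigmaN m = (⋂ i, ⋂ j, {μ | i < j → μ j < μ i}) ∩ posOrthant m := by
    ext μ
    simp [SigmaN, posOrthant]
  rw [h]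
  refine (MeasurableSet.iInter fun i => MeasurableSet.iInter fun j => ?_).inter
    (measurableSet_posOrthant m)
  by_cases hij : i < j
  · simp only [hij, true_imp_iff]
    exact measurableSet_lt (by fun_prop) (by fun_prop)
  · simp [hij]

theorem coe_piCongrLeft_symm {m : ℕ} (σ : Equiv.Perm (Fin m)) :
    ⇑(MeasurableEquiv.piCongrLeft (fun _ : Fin m => ℝ) σ.symm) = fun μ => μ ∘ σ := by
  funext μ i
  have := Equiv.piCongrLeft_apply_apply (fun _ : Fin m => ℝ) σ.symm μ (σ i)
  rw [Equiv.symm_apply_apply] at this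
  exact this

theorem measurePreserving_comp_perm {m : ℕ} (σ : Equiv.Perm (Fin m)) :
    MeasurePreserving (fun μ : Fin m → ℝ => μ ∘ σ) := by
  have h := volume_measurePreserving_piCongrLeft (fun _ : Fin m => ℝ) σ.symm
  rwa [coe_piCongrLeft_symm] at h

theorem measurableEmbedding_comp_perm {m : ℕ} (σ : Equiv.Perm (Fin m)) :
    MeasurableEmbedding (fun μ : Fin m → ℝ => μ ∘ σ) := by
  have h := (MeasurableEquiv.piCongrLeft (fun _ : Fin m => ℝ) σ.symm).measurableEmbedding
  rwa [coe_piCongrLeft_symm] at h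

theorem setIntegral_windowSet_le_factorial_mul (m : ℕ) (N a c δ : ℝ) {t : ℝ} (ht : 0 < t) :
    ∫ μ in windowSet m N a c δ, scaledWeight m t μ
      ≤ m.factorial * ∫ μ in windowSet m N a c δ ∩ SigmaN m, scaledWeight m t μ := by
  set A := windowSet m N a c δ with hA
  have mA : MeasurableSet A := measurableSet_windowSet m N a c δ
  have mB : MeasurableSet (A ∩ SigmaN m) := mA.inter (measurableSet_SigmaN m)
  have iA : IntegrableOn (scaledWeight m t) A :=
    (integrableOn_scaledWeight m ht).mono_set (windowSet_subset_posOrthant _ _ _ _ _)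
  have iB : IntegrableOn (scaledWeight m t) (A ∩ SigmaN m) := iA.mono_set Set.inter_subset_left
  set g : (Fin m → ℝ) → ℝ := (A ∩ SigmaN m).indicator (scaledWeight m t) with hg
  have ig : Integrable g := (integrable_indicator_iff mB).2 iB
  have hg0 : ∀ μ, 0 ≤ g μ := Set.indicator_nonneg fun μ _ => scaledWeight_nonneg m t μ
  have igσ : ∀ σ : Equiv.Perm (Fin m), Integrable fun μ => g (μ ∘ σ) := fun σ =>
    (measurePreserving_comp_perm σ).integrable_comp_of_integrable ig
  have hpt : ∀ μ, A.indicator (scaledWeight m t) μ ≤ ∑ σ : Equiv.Perm (Fin m), g (μ ∘ σ) := by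
    intro μ
    by_cases hμ : μ ∈ A ∧ VdM m μ ≠ 0
    · obtain ⟨σ, hσ⟩ := exists_perm_comp_mem_SigmaN hμ.1.1 (injective_of_VdM_ne_zero hμ.2)
      have h1 : A.indicator (scaledWeight m t) μ = g (μ ∘ σ) := by
        rw [Set.indicator_of_mem hμ.1, hg,
          Set.indicator_of_mem (Set.mem_inter (comp_perm_mem_windowSet σ hμ.1) hσ),
          scaledWeight_comp_perm]
      rw [h1]
      exact Finset.single_le_sum (f := fun σ : Equiv.Perm (Fin m) => g (μ ∘ σ))
        (fun σ _ => hg0 _) (Finset.mem_univ σ)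
    · have h1 : A.indicator (scaledWeight m t) μ = 0 := by
        by_cases hμA : μ ∈ A
        · have : VdM m μ = 0 := by
            by_contra h
            exact hμ ⟨hμA, h⟩
          simp [scaledWeight, this]
        · exact Set.indicator_of_notMem hμA _
      rw [h1]
      exact Finset.sum_nonneg fun σ _ => hg0 _
  have h := integral_mono ((integrable_indicator_iff mA).2 iA)
    (integrable_finsetSum Finset.univ fun σ _ => igσ σ) hpt
  rw [integral_indicator mA, integral_finsetSum _ fun σ _ => igσ σ] at h
  have hs : ∀ σ : Equiv.Perm (Fin m), ∫ μ, g (μ ∘ σ)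
      = ∫ μ in A ∩ SigmaN m, scaledWeight m t μ := fun σ => by
    rw [(measurePreserving_comp_perm σ).integral_comp (measurableEmbedding_comp_perm σ) g,
      integral_indicator mB]
  simpa [hs, Fintype.card_perm] using h

/-! ### Asymptotics -/

theorem exp_mul_setIntegral_scaledWeight_le (m : ℕ) {N a a₁ c δ : ℝ} (h₁ : 1 ≤ a₁) :
    Real.exp (-((1 - 1 / a₁) * (c * N)) / 2) *
        ∫ μ in windowSet m N a c δ, scaledWeight m (1 / a₁) μ
      ≤ ∫ μ in windowSet m N a c δ, scaledWeight m 1 μ := by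
  have ht : 0 < 1 / a₁ := one_div_pos.2 (by linarith)
  have hsub := windowSet_subset_posOrthant m N a c δ
  rw [← integral_const_mul]
  refine setIntegral_mono_on
    (((integrableOn_scaledWeight m ht).mono_set hsub).const_mul _)
    ((integrableOn_scaledWeight m one_pos).mono_set hsub)
    (measurableSet_windowSet m N a c δ) fun μ hμ => ?_
  rw [scaledWeight, scaledWeight, mul_left_comm, ← Real.exp_add]
  refine mul_le_mul_of_nonneg_left (Real.exp_le_exp.2 ?_) (sq_nonneg _)
  have h2 : 0 ≤ 1 - 1 / a₁ := sub_nonneg.2 ((div_le_one (by linarith)).2 h₁)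
  have := mul_le_mul_of_nonneg_left hμ.2.1.2.le h2
  linarith

theorem cast_choose_two_mul (m : ℕ) : (((2 * m).choose 2 : ℕ) : ℝ) = m * (2 * m - 1) := by
  rw [Nat.cast_choose_two]; push_cast; ring

open Filter Topology in
theorem eventually_half_le_concentration {a a₁ c δ : ℝ} (ha : 0 < a) (haa : a < a₁)
    (hac : a₁ < c) (hδ : 0 < δ) :
    ∀ᶠ m : ℕ in atTop, 1 / 2 ≤ 1 - chernoffRate (a / a₁) ^ (2 * m).choose 2
      - chernoffRate (c / a₁) ^ (2 * m).choose 2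
      - 84 * a₁ ^ 2 * (m : ℝ) ^ 3 / (δ * (2 * m).choose 2) ^ 2 := by
  have h₁ : 0 < a₁ := ha.trans haa
  have hN : Tendsto (fun m : ℕ => (2 * m).choose 2) atTop atTop := by
    refine tendsto_atTop_mono (fun m => ?_) tendsto_id
    rw [← add_four_mul_choose_two]
    exact Nat.le_add_right _ _
  have t1 := (tendsto_pow_atTop_nhds_zero_of_lt_one (chernoffRate_nonneg (a / a₁))
    (chernoffRate_lt_one ((div_lt_one h₁).2 haa).ne)).comp hN
  have t2 := (tendsto_pow_atTop_nhds_zero_of_lt_one (chernoffRate_nonneg (c / a₁))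
    (chernoffRate_lt_one ((one_lt_div h₁).2 hac).ne')).comp hN
  have t3 : Tendsto (fun m : ℕ => 84 * a₁ ^ 2 * (m : ℝ) ^ 3 / (δ * (2 * m).choose 2) ^ 2)
      atTop (𝓝 0) := by
    refine squeeze_zero' (Eventually.of_forall fun m => by positivity) ?_
      (tendsto_const_div_atTop_nhds_zero_nat (84 * a₁ ^ 2 / δ ^ 2))
    filter_upwards [eventually_ge_atTop 1] with m hm
    have hm' : (1 : ℝ) ≤ m := by exact_mod_cast hm
    rw [cast_choose_two_mul]
    have h2 : (δ * (m : ℝ) ^ 2) ^ 2 ≤ (δ * (m * (2 * m - 1))) ^ 2 := by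
      gcongr
      nlinarith
    calc 84 * a₁ ^ 2 * (m : ℝ) ^ 3 / (δ * (m * (2 * m - 1))) ^ 2
        ≤ 84 * a₁ ^ 2 * (m : ℝ) ^ 3 / (δ * (m : ℝ) ^ 2) ^ 2 := by gcongr
      _ = 84 * a₁ ^ 2 / δ ^ 2 / m := by field_simp
  have t := ((tendsto_const_nhds (x := (1 : ℝ))).sub t1).sub t2 |>.sub t3
  simp only [sub_zero] at t
  exact (t.eventually (lt_mem_nhds (by norm_num : (1 / 2 : ℝ) < 1))).mono fun m h => h.le

theorem le_setIntegral_windowSet_inter_SigmaN {m : ℕ} (hm : 0 < m) {a a₁ c δ : ℝ} (ha : 1 ≤ a)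
    (haa : a < a₁) (hac : a₁ < c) (hδ : 0 < δ)
    (hconc : 1 / 2 ≤ 1 - chernoffRate (a / a₁) ^ (2 * m).choose 2
      - chernoffRate (c / a₁) ^ (2 * m).choose 2
      - 84 * a₁ ^ 2 * (m : ℝ) ^ 3 / (δ * (2 * m).choose 2) ^ 2) :
    chamberMass m * (Real.exp ((Real.log a₁ - (1 - 1 / a₁) * c) * (2 * m).choose 2 / 2) * (1 / 2))
      ≤ ∫ μ in windowSet m ((2 * m).choose 2) a c δ ∩ SigmaN m, scaledWeight m 1 μ := by
  have h₁ : 0 < a₁ := by linarith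
  have hf : (0 : ℝ) < m.factorial := by exact_mod_cast m.factorial_pos
  have h1 := le_setIntegral_windowSet_scaledWeight hm (by linarith : 0 < a) haa hac hδ
  have h2 := exp_mul_setIntegral_scaledWeight_le m (N := (2 * m).choose 2) (a := a) (c := c)
    (δ := δ) (by linarith : 1 ≤ a₁)
  have h3 := setIntegral_windowSet_le_factorial_mul m ((2 * m).choose 2) a c δ one_pos
  have h4 : (√(1 / a₁) ^ (2 * m).choose 2)⁻¹
      = Real.exp (Real.log a₁ * (2 * m).choose 2 / 2) := by
    rw [one_div, Real.sqrt_inv, inv_pow, inv_inv, Real.sqrt_eq_rpow, ← Real.rpow_natCast,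
      ← Real.rpow_mul h₁.le, Real.rpow_def_of_pos h₁]
    congr 1; ring
  have h5 : (0 : ℝ) ≤ (√(1 / a₁) ^ (2 * m).choose 2)⁻¹ * (m.factorial * chamberMass m) :=
    mul_nonneg (by positivity) (mul_nonneg hf.le (chamberMass_pos m).le)
  have h6 := mul_le_mul_of_nonneg_left ((mul_le_mul_of_nonneg_left hconc h5).trans h1)
    (Real.exp_pos (-((1 - 1 / a₁) * (c * (2 * m).choose 2)) / 2)).le
  have h7 := (h6.trans h2).trans h3
  refine le_of_mul_le_mul_left (le_trans (le_of_eq ?_) h7) hf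
  rw [h4, show (Real.log a₁ - (1 - 1 / a₁) * c) * ((2 * m).choose 2 : ℝ) / 2
    = -((1 - 1 / a₁) * (c * (2 * m).choose 2)) / 2 + Real.log a₁ * (2 * m).choose 2 / 2 by ring,
    Real.exp_add]
  ring

theorem le_setIntegral_SigABD {m : ℕ} (hm : 0 < m) {a a₁ b c δ : ℝ} (ha : 1 ≤ a)
    (haa : a < a₁) (hac : a₁ < c) (hcb : c ≤ b) (hδ : 0 < δ)
    (hconc : 1 / 2 ≤ 1 - chernoffRate (a / a₁) ^ (2 * m).choose 2
      - chernoffRate (c / a₁) ^ (2 * m).choose 2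
      - 84 * a₁ ^ 2 * (m : ℝ) ^ 3 / (δ * (2 * m).choose 2) ^ 2) :
    Real.exp ((Real.log a₁ - (1 - 1 / a₁) * c) * (2 * m).choose 2 / 2) * (1 / 2)
      ≤ ∫ μ in SigABD (2 * m) a b δ, (Zn (2 * m))⁻¹ * (VdM ((2 * m) / 2) μ) ^ 2
            * Real.exp (-(∑ j, μ j ^ 2) / 2) := by
  have hk : (2 * m) / 2 = m := Nat.mul_div_cancel_left _ (by norm_num)
  have hZ : Zn (2 * m) = chamberMass ((2 * m) / 2) := by rw [hk, chamberMass_eq_Zn]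
  have hZpos := chamberMass_pos ((2 * m) / 2)
  have hlow := le_setIntegral_windowSet_inter_SigmaN (m := (2 * m) / 2) (by omega) ha haa hac hδ
    (by rw [hk]; exact hconc)
  have hN : (2 * ((2 * m) / 2)).choose 2 = (2 * m).choose 2 := by rw [hk]
  rw [hN] at hlow
  have hN0 : (0 : ℝ) ≤ ((2 * m).choose 2 : ℕ) := Nat.cast_nonneg _
  have hsub : windowSet ((2 * m) / 2) ((2 * m).choose 2) a c δ ∩ SigmaN ((2 * m) / 2)
      ⊆ SigABD (2 * m) a b δ := fun μ hμ =>
    ⟨hμ.2, ⟨hμ.1.2.1.1, hμ.1.2.1.2.trans_le (mul_le_mul_of_nonneg_right hcb hN0)⟩, hμ.1.2.2⟩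
  have hpos : SigABD (2 * m) a b δ ⊆ posOrthant ((2 * m) / 2) := fun μ hμ => hμ.1.2
  have hmono : ∫ μ in windowSet ((2 * m) / 2) ((2 * m).choose 2) a c δ ∩ SigmaN ((2 * m) / 2),
      scaledWeight ((2 * m) / 2) 1 μ
      ≤ ∫ μ in SigABD (2 * m) a b δ, scaledWeight ((2 * m) / 2) 1 μ :=
    setIntegral_mono_set ((integrableOn_scaledWeight _ one_pos).mono_set hpos)
      (Filter.Eventually.of_forall fun μ => scaledWeight_nonneg _ _ μ) hsub.eventuallyLE
  have h := hlow.trans hmono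
  simp only [mul_assoc, ← scaledWeight_one]
  rw [integral_const_mul, hZ, inv_mul_eq_div, le_div_iff₀ hZpos, mul_comm]
  simpa only [mul_assoc] using h

open Filter Topology in
theorem tendsto_normalized_rate (L : ℝ) :
    Tendsto (fun m : ℕ => 4 / (2 * m : ℝ) ^ 2 * (L * (2 * m).choose 2 / 2 - Real.log 2))
      atTop (𝓝 L) := by
  have t1 := tendsto_const_div_atTop_nhds_zero_nat (L / 2)
  have t2 := (tendsto_const_div_atTop_nhds_zero_nat (Real.log 2)).mul
    (tendsto_one_div_atTop_nhds_zero_nat (𝕜 := ℝ))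
  have t := ((tendsto_const_nhds (x := L)).sub t1).sub t2
  simp only [sub_zero, mul_zero] at t
  refine t.congr' ?_
  filter_upwards [eventually_ge_atTop 1] with m hm
  have hm' : (m : ℝ) ≠ 0 := by exact_mod_cast (by omega : m ≠ 0)
  rw [cast_choose_two_mul]
  field_simp
  ring

open Filter Topology in
theorem exists_tilt_lt {a b z : ℝ} (ha : 1 ≤ a) (hab : a < b) (hz : z < 1 - a + Real.log a) :
    ∃ a₁ c, a < a₁ ∧ a₁ < c ∧ c ≤ b ∧ z < Real.log a₁ - (1 - 1 / a₁) * c := by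
  have ha0 : a ≠ 0 := by linarith
  have hcont : ContinuousAt (fun x : ℝ => Real.log x - (1 - 1 / x) * (2 * x - a)) a := by
    fun_prop (disch := assumption)
  have h1 : z < Real.log a - (1 - 1 / a) * (2 * a - a) := by
    have : (1 - 1 / a) * (2 * a - a) = a - 1 := by field_simp; ring
    linarith
  have e1 : ∀ᶠ x in 𝓝[>] a, z < Real.log x - (1 - 1 / x) * (2 * x - a) :=
    nhdsWithin_le_nhds (hcont.eventually (lt_mem_nhds h1))
  have e2 : ∀ᶠ x in 𝓝[>] a, x < (a + b) / 2 :=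
    nhdsWithin_le_nhds (gt_mem_nhds (by linarith))
  have e3 : ∀ᶠ x in 𝓝[>] a, a < x := eventually_mem_nhdsWithin
  obtain ⟨x, h1, h2, h3⟩ := (e1.and (e2.and e3)).exists
  exact ⟨x, 2 * x - a, h3, by linarith, by linarith, h1⟩

theorem stmt10 (a b δ : ℝ) (ha : 1 ≤ a) (hab : a < b) (hδ : 0 < δ) :
    ((1 - a + Real.log a : ℝ) : EReal) ≤ Filter.liminf (fun m : ℕ =>
      (((4 / (2 * m : ℝ) ^ 2) * Real.log (∫ μ in SigABD (2 * m) a b δ,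
          (Zn (2 * m))⁻¹ * (VdM ((2 * m) / 2) μ) ^ 2
            * Real.exp (-(∑ j, μ j ^ 2) / 2)) : ℝ) : EReal))
      Filter.atTop := by
  refine EReal.ge_of_forall_gt_iff_ge.1 fun z hz => ?_
  obtain ⟨a₁, c, haa, hac, hcb, hL⟩ := exists_tilt_lt ha hab (EReal.coe_lt_coe_iff.1 hz)
  refine Filter.le_liminf_of_le (by isBoundedDefault) ?_
  filter_upwards [eventually_half_le_concentration (by linarith) haa hac hδ,
    (tendsto_normalized_rate _).eventually (lt_mem_nhds hL),
    Filter.eventually_gt_atTop 0] with m hconc hrate hm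
  refine EReal.coe_le_coe_iff.2 (hrate.le.trans (mul_le_mul_of_nonneg_left ?_ (by positivity)))
  have h := Real.log_le_log (by positivity) (le_setIntegral_SigABD hm ha haa hac hcb hδ hconc)
  have hlog : Real.log (1 / 2) = -Real.log 2 := by rw [one_div, Real.log_inv]
  rw [Real.log_mul (Real.exp_pos _).ne' (by norm_num), Real.log_exp, hlog] at h
  linarith
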